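/- Let m ≥ 2 and let λ = ((n₁, …, n_m), (k₁, …, k_m)) be a pair of integer m-tuples with n₁ > n₂ > ⋯ > n_m > 0. If n₂ + n_m > n₁ then T̃₀(C(T̃₀(λ))) = C(λ), and if n₂ + n_m < n₁ then T̃₁(C(T̃₁(λ))) = C(λ); that is, the extended slow-Triangle map respects conjugation of Young shapes. -/

import Mathlib

/-- Parts component of the branch `T̃₀` of the extended slow-Triangle map:
`(n₁, …, n_m) ↦ (n₂, n₃, …, n_m, n₁ − n₂)` (entries are indexed `1, …, m`;
all other indices are left unchanged). -/
def Tpart0 (m : ℕ) (f : ℕ → ℤ) : ℕ → ℤ := fun i =>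
  if 1 ≤ i ∧ i < m then f (i + 1) else if i = m then f 1 - f 2 else f i

/-- Multiplicities component of `T̃₀`: `(k₁, …, k_m) ↦ (k₁ + k₂, k₃, …, k_m, k₁)`. -/
def Tmult0 (m : ℕ) (g : ℕ → ℤ) : ℕ → ℤ := fun i =>
  if i = 1 then g 1 + g 2
  else if 2 ≤ i ∧ i < m then g (i + 1)
  else if i = m then g 1 else g i

/-- Parts component of `T̃₁`: `(n₁, …, n_m) ↦ (n₁ − n_m, n₂, …, n_m)`. -/
def Tpart1 (m : ℕ) (f : ℕ → ℤ) : ℕ → ℤ := fun i =>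
  if i = 1 then f 1 - f m else f i

/-- Multiplicities component of `T̃₁`: `(k₁, …, k_m) ↦ (k₁, …, k_{m−1}, k₁ + k_m)`. -/
def Tmult1 (m : ℕ) (g : ℕ → ℤ) : ℕ → ℤ := fun i =>
  if i = m then g 1 + g m else g i

/-- The branch `T̃₀` of the extended slow-Triangle map, acting on pairs of `m`-tuples
(parts, multiplicities), encoded as pairs of functions `ℕ → ℤ` indexed by `1, …, m`. -/
def Ttilde0 (m : ℕ) (p : (ℕ → ℤ) × (ℕ → ℤ)) : (ℕ → ℤ) × (ℕ → ℤ) :=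
  (Tpart0 m p.1, Tmult0 m p.2)

/-- The branch `T̃₁` of the extended slow-Triangle map. -/
def Ttilde1 (m : ℕ) (p : (ℕ → ℤ) × (ℕ → ℤ)) : (ℕ → ℤ) × (ℕ → ℤ) :=
  (Tpart1 m p.1, Tmult1 m p.2)

/-- Conjugation (flipping the Young shape) of the partition
`(n₁, …, n_m) × [k₁, …, k_m]`: the new parts are `n'_i = k₁ + ⋯ + k_{m+1−i}` and the new
multiplicities are `k'_i = n_{m+1−i} − n_{m+2−i}`, with the convention `n_{m+1} = 0`. -/
def Cconj (m : ℕ) (p : (ℕ → ℤ) × (ℕ → ℤ)) : (ℕ → ℤ) × (ℕ → ℤ) :=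
  (fun i => if 1 ≤ i ∧ i ≤ m then ∑ j ∈ Finset.Icc 1 (m + 1 - i), p.2 j else p.1 i,
   fun i => if 1 ≤ i ∧ i ≤ m then
      p.1 (m + 1 - i) - (if i = 1 then 0 else p.1 (m + 2 - i)) else p.2 i)

theorem sum_Tmult0_of_lt {m j : ℕ} (g : ℕ → ℤ) (hj : 1 ≤ j) (hjm : j < m) :
    ∑ i ∈ Finset.Icc 1 j, Tmult0 m g i = ∑ i ∈ Finset.Icc 1 (j + 1), g i := by
  induction j, hj using Nat.le_induction with
  | base => simp [Tmult0, Finset.sum_Icc_succ_top]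
  | succ j hj ih =>
    rw [Finset.sum_Icc_succ_top (by omega), Finset.sum_Icc_succ_top (by omega),
      ih (by omega)]
    have : Tmult0 m g (j + 1) = g (j + 1 + 1) := by grind [Tmult0]
    rw [this]

theorem sum_Tmult0_self {m : ℕ} (hm : 2 ≤ m) (g : ℕ → ℤ) :
    ∑ i ∈ Finset.Icc 1 m, Tmult0 m g i = ∑ i ∈ Finset.Icc 1 m, g i + g 1 := by
  obtain ⟨m, rfl⟩ := Nat.exists_eq_add_of_le' (show 1 ≤ m by omega)
  rw [Finset.sum_Icc_succ_top (by omega), sum_Tmult0_of_lt g (by omega) (by omega)]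
  have : Tmult0 (m + 1) g (m + 1) = g 1 := by grind [Tmult0]
  rw [this]

theorem sum_Tmult1_of_lt {m j : ℕ} (g : ℕ → ℤ) (hjm : j < m) :
    ∑ i ∈ Finset.Icc 1 j, Tmult1 m g i = ∑ i ∈ Finset.Icc 1 j, g i :=
  Finset.sum_congr rfl fun i hi => by grind [Tmult1]

theorem sum_Tmult1_self {m : ℕ} (hm : 1 ≤ m) (g : ℕ → ℤ) :
    ∑ i ∈ Finset.Icc 1 m, Tmult1 m g i = ∑ i ∈ Finset.Icc 1 m, g i + g 1 := by
  obtain ⟨m, rfl⟩ := Nat.exists_eq_add_of_le' hm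
  rw [Finset.sum_Icc_succ_top (by omega), Finset.sum_Icc_succ_top (by omega),
    sum_Tmult1_of_lt g (by omega)]
  simp only [Tmult1, if_true]
  ring

theorem Ttilde0_Cconj_Ttilde0 {m : ℕ} (hm : 2 ≤ m) (p : (ℕ → ℤ) × (ℕ → ℤ)) :
    Ttilde0 m (Cconj m (Ttilde0 m p)) = Cconj m p := by
  obtain ⟨f, g⟩ := p
  have hs := @sum_Tmult0_of_lt m
  have ht := sum_Tmult0_self hm g
  have h1 : ∑ i ∈ Finset.Icc 1 1, g i = g 1 := by simp
  refine Prod.ext (funext fun i => ?_) (funext fun i => ?_)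
  · simp only [Ttilde0, Cconj]
    generalize hT : Tmult0 m g = T at *
    grind [Tpart0]
  · simp only [Ttilde0, Cconj]
    grind [Tpart0, Tmult0]

theorem Ttilde1_Cconj_Ttilde1 {m : ℕ} (hm : 2 ≤ m) (p : (ℕ → ℤ) × (ℕ → ℤ)) :
    Ttilde1 m (Cconj m (Ttilde1 m p)) = Cconj m p := by
  obtain ⟨f, g⟩ := p
  have hs := @sum_Tmult1_of_lt m
  have ht := sum_Tmult1_self (show 1 ≤ m by omega) g
  have h1 : ∑ i ∈ Finset.Icc 1 1, g i = g 1 := by simp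
  refine Prod.ext (funext fun i => ?_) (funext fun i => ?_)
  · simp only [Ttilde1, Cconj]
    grind [Tpart1]
  · simp only [Ttilde1, Cconj]
    grind [Tpart1, Tmult1]

/-- The extended slow-Triangle map respects conjugation of Young shapes:
for a partition `λ` with strictly decreasing positive parts, if `n₂ + n_m > n₁` then
`T̃₀(C(T̃₀(λ))) = C(λ)`, and if `n₂ + n_m < n₁` then `T̃₁(C(T̃₁(λ))) = C(λ)`. -/
theorem triangle_respects_conjugation (m : ℕ) (hm : 2 ≤ m) (p : (ℕ → ℤ) × (ℕ → ℤ))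
    (hdec : ∀ i, 1 ≤ i → i < m → p.1 (i + 1) < p.1 i)
    (hpos : 0 < p.1 m) :
    (p.1 1 < p.1 2 + p.1 m → Ttilde0 m (Cconj m (Ttilde0 m p)) = Cconj m p) ∧
      (p.1 2 + p.1 m < p.1 1 → Ttilde1 m (Cconj m (Ttilde1 m p)) = Cconj m p) := by
  exact ⟨fun _ => Ttilde0_Cconj_Ttilde0 hm p, fun _ => Ttilde1_Cconj_Ttilde1 hm p⟩
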